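/- Let ρ ≥ 0, δ > 0 and ε > 0, let h be the smallest integer with h > ρ/δ, and set θ_{δ,ρ}(ε) = min{1, 2ε/((h+1)(h+2))}. There exists b ∈ ℤ_{≥0}, depending only on δ, ρ and ε, such that for every positively convex polygon N and every chain N ⇝ N^{(1)} ⇝ ⋯ ⇝ N^{(t)} of (δ,ρ,ε)-planning operations one has t ≤ b. -/

import Mathlib

noncomputable section
open Classical

/-- Positive convex hull: convex hull plus the positive quadrant. -/
def posHullSet (S : Set (ℝ × ℝ)) : Set (ℝ × ℝ) :=
  {p | ∃ c ∈ convexHull ℝ S, ∃ d : ℝ × ℝ, 0 ≤ d.1 ∧ 0 ≤ d.2 ∧ p = c + d}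

/-- A positively convex polygon: generated by a cloud of points of `ℝ_{≥0} × ℤ_{≥0}`. -/
def PosConvex (N : Set (ℝ × ℝ)) : Prop :=
  ∃ C : Set (ℝ × ℝ), (∀ q ∈ C, 0 ≤ q.1 ∧ ∃ m : ℕ, q.2 = (m : ℝ)) ∧ N = posHullSet C

/-- Abscissa of the polygon at height `s` (`∞` if the row is empty). -/
def lamN (N : Set (ℝ × ℝ)) (s : ℤ) : EReal :=
  sInf {v : EReal | ∃ l : ℝ, (l, (s : ℝ)) ∈ N ∧ v = (l : EReal)}

/-- Sharpness of the polygon at height `s`: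
`α_N(s) = λ_N(s−1) + λ_N(s+1) − 2λ_N(s)`, with the conventions `α_N(s) = 0` when
`λ_N(s) = ∞` and `α_N(s) = ∞` when `λ_N(s) < ∞` and `λ_N(s−1) = ∞`. -/
def sharpN (N : Set (ℝ × ℝ)) (s : ℤ) : EReal :=
  if lamN N s = ⊤ then 0
  else if lamN N (s - 1) = ⊤ then ⊤
  else lamN N (s - 1) + lamN N (s + 1) - 2 * lamN N s

/-- `ς_δ(N) = inf{a + δ·b : (a,b) ∈ N}`. -/
def sigN (N : Set (ℝ × ℝ)) (δ : ℝ) : EReal :=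
  sInf {v : EReal | ∃ p ∈ N, v = ((p.1 + δ * p.2 : ℝ) : EReal)}

/-- `χ_δ(N)`: the ordinate of the highest vertex on the critical line of slope `−1/δ`. -/
def chiN (N : Set (ℝ × ℝ)) (δ : ℝ) : ℕ :=
  sSup {s : ℕ | lamN N (s : ℤ) + ((δ * s : ℝ) : EReal) = sigN N δ}

/-- The set of vertices of a polygon. -/
def vertSet (N : Set (ℝ × ℝ)) : Set (ℝ × ℝ) :=
  {p | ∃ s : ℕ, p.2 = (s : ℝ) ∧ (p.1 : EReal) = lamN N (s : ℤ) ∧ 0 < sharpN N (s : ℤ)}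

/-- The generating cloud for an `s`-planning: the vertices of `N` other than
`(λ_N(s), s)`, together with `(λ_N(s−1), s−1)` and `(λ_N(s+1), s+1)`. -/
def genSet (N : Set (ℝ × ℝ)) (s : ℕ) : Set (ℝ × ℝ) :=
  {p | p ∈ vertSet N ∧ ¬ (p.2 = (s : ℝ) ∧ (p.1 : EReal) = lamN N (s : ℤ))} ∪
  {p | ∃ t : ℤ, (t = (s : ℤ) - 1 ∨ t = (s : ℤ) + 1) ∧ p.2 = (t : ℝ) ∧ (p.1 : EReal) = lamN N t}

/-- `N'` is an `s`-planning of `N`. -/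
def IsPlanning (N N' : Set (ℝ × ℝ)) (s : ℕ) : Prop :=
  N' ⊆ posHullSet (genSet N s)

/-- `θ_{δ,ρ}(ε) = min{1, 2ε/((h+1)(h+2))}` where `h` is the smallest integer `> ρ/δ`. -/
def thetaVal (δ ρ ε : ℝ) (h : ℕ) : ℝ :=
  min 1 (2 * ε / (((h : ℝ) + 1) * ((h : ℝ) + 2)))

/-- A `(δ,ρ,ε)`-planning operation. -/
def PlanOp (δ ρ ε : ℝ) (h : ℕ) (N N' : Set (ℝ × ℝ)) : Prop :=
  PosConvex N' ∧ ∃ s : ℕ, lamN N (s : ℤ) < ((ρ - s * δ : ℝ) : EReal) ∧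
    ((thetaVal δ ρ ε h : ℝ) : EReal) ≤ sharpN N (s : ℤ) ∧ IsPlanning N N' s

theorem posHullSet_halfPlane {S : Set (ℝ × ℝ)} {a b c : ℝ} (ha : 0 ≤ a) (hb : 0 ≤ b)
    (hS : ∀ p ∈ S, c ≤ a * p.1 + b * p.2) {p : ℝ × ℝ} (hp : p ∈ posHullSet S) :
    c ≤ a * p.1 + b * p.2 := by
  obtain ⟨q, hq, d, hd1, hd2, rfl⟩ := hp
  have hconv : Convex ℝ {q : ℝ × ℝ | c ≤ a * q.1 + b * q.2} := by
    intro x hx y hy u v hu hv huv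
    simp only [Set.mem_ofPred_eq, Prod.fst_add, Prod.snd_add, Prod.smul_fst, Prod.smul_snd,
      smul_eq_mul] at hx hy ⊢
    have hv' : v = 1 - u := by linarith
    subst hv'
    nlinarith [mul_le_mul_of_nonneg_left hx hu, mul_le_mul_of_nonneg_left hy hv]
  have hq' : c ≤ a * q.1 + b * q.2 := convexHull_min hS hconv hq
  have h1 := mul_nonneg ha hd1
  have h2 := mul_nonneg hb hd2
  simp only [Prod.fst_add, Prod.snd_add]
  linarith

namespace PosConvex

variable {N : Set (ℝ × ℝ)}

theorem fst_nonneg (hN : PosConvex N) {p : ℝ × ℝ} (hp : p ∈ N) : 0 ≤ p.1 := by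
  obtain ⟨C, hC, rfl⟩ := hN
  simpa using posHullSet_halfPlane (a := 1) (b := 0) (c := 0) zero_le_one le_rfl
    (fun q hq => by simpa using (hC q hq).1) hp

theorem snd_nonneg (hN : PosConvex N) {p : ℝ × ℝ} (hp : p ∈ N) : 0 ≤ p.2 := by
  obtain ⟨C, hC, rfl⟩ := hN
  have hC2 : ∀ q ∈ C, 0 ≤ 0 * q.1 + 1 * q.2 := fun q hq => by
    obtain ⟨m, hm⟩ := (hC q hq).2
    simp [hm]
  simpa using posHullSet_halfPlane le_rfl zero_le_one hC2 hp

theorem add_mem (hN : PosConvex N) {p d : ℝ × ℝ} (hp : p ∈ N) (h1 : 0 ≤ d.1) (h2 : 0 ≤ d.2) :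
    p + d ∈ N := by
  obtain ⟨C, -, rfl⟩ := hN
  obtain ⟨c, hc, e, he1, he2, rfl⟩ := hp
  exact ⟨c, hc, e + d, add_nonneg he1 h1, add_nonneg he2 h2, add_assoc _ _ _⟩

theorem convex (hN : PosConvex N) : Convex ℝ N := by
  obtain ⟨C, -, rfl⟩ := hN
  rintro _ ⟨c, hc, d, hd1, hd2, rfl⟩ _ ⟨c', hc', d', hd1', hd2', rfl⟩ u v hu hv huv
  refine ⟨u • c + v • c', convex_convexHull ℝ C hc hc' hu hv huv, u • d + v • d', ?_, ?_, ?_⟩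
  · simp only [Prod.fst_add, Prod.smul_fst, smul_eq_mul]; positivity
  · simp only [Prod.snd_add, Prod.smul_snd, smul_eq_mul]; positivity
  · simp only [smul_add]; abel

end PosConvex

theorem lamN_le_of_mem {N : Set (ℝ × ℝ)} {l : ℝ} {t : ℤ} (h : (l, (t : ℝ)) ∈ N) :
    lamN N t ≤ (l : EReal) :=
  sInf_le ⟨l, h, rfl⟩

theorem exists_mem_of_lamN_lt {N : Set (ℝ × ℝ)} {x : ℝ} {t : ℤ} (h : lamN N t < (x : EReal)) :
    ∃ l < x, (l, (t : ℝ)) ∈ N := by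
  obtain ⟨_, ⟨l, hl, rfl⟩, hlx⟩ := sInf_lt_iff.1 h
  exact ⟨l, EReal.coe_lt_coe_iff.1 hlx, hl⟩

namespace PosConvex

variable {N : Set (ℝ × ℝ)}

theorem lamN_nonneg (hN : PosConvex N) (t : ℤ) : 0 ≤ lamN N t := by
  refine le_sInf ?_
  rintro _ ⟨l, hl, rfl⟩
  exact EReal.coe_nonneg.2 (hN.fst_nonneg hl)

theorem exists_lamN_eq_coe (hN : PosConvex N) {t : ℤ} (h : lamN N t ≠ ⊤) :
    ∃ a : ℝ, lamN N t = a :=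
  ⟨(lamN N t).toReal,
    (EReal.coe_toReal h (ne_bot_of_le_ne_bot EReal.zero_ne_bot (hN.lamN_nonneg t))).symm⟩

theorem lamN_antitone (hN : PosConvex N) : Antitone (lamN N) := by
  intro i j hij
  refine le_sInf ?_
  rintro _ ⟨l, hl, rfl⟩
  refine lamN_le_of_mem ?_
  have hij' : (i : ℝ) ≤ j := by exact_mod_cast hij
  simpa using hN.add_mem (d := (0, (j : ℝ) - i)) hl le_rfl (sub_nonneg.2 hij')

theorem lamN_convex (hN : PosConvex N) {i j k : ℤ} {a b c : ℝ} (hij : i ≤ j) (hjk : j ≤ k)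
    (ha : lamN N i = a) (hb : lamN N j = b) (hc : lamN N k = c) :
    ((k : ℝ) - i) * b ≤ (k - j) * a + (j - i) * c := by
  have hij' : (0 : ℝ) ≤ j - i := sub_nonneg.2 (by exact_mod_cast hij)
  have hjk' : (0 : ℝ) ≤ k - j := sub_nonneg.2 (by exact_mod_cast hjk)
  rcases (show i ≤ k by lia).eq_or_lt with hik | hik
  · obtain rfl : i = k := hik
    obtain rfl : i = j := by lia
    simp
  have hik' : (0 : ℝ) < k - i := sub_pos.2 (by exact_mod_cast hik)
  refine le_of_forall_pos_le_add fun η hη => ?_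
  have hη' : 0 < η / (k - i) := by positivity
  obtain ⟨x, hx, hxN⟩ := exists_mem_of_lamN_lt (N := N) (t := i) (x := a + η / (k - i))
    (by rw [ha]; exact_mod_cast lt_add_of_pos_right a hη')
  obtain ⟨y, hy, hyN⟩ := exists_mem_of_lamN_lt (N := N) (t := k) (x := c + η / (k - i))
    (by rw [hc]; exact_mod_cast lt_add_of_pos_right c hη')
  have hmem := hN.convex hxN hyN (a := (k - j) / (k - i)) (b := (j - i) / (k - i))
    (by positivity) (by positivity) (by field_simp; ring)
  have hrow : ((k : ℝ) - j) / (k - i) * i + (j - i) / (k - i) * k = j := by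
    field_simp; ring
  simp only [Prod.smul_mk, smul_eq_mul, Prod.mk_add_mk, hrow] at hmem
  have hle := lamN_le_of_mem hmem
  rw [hb, EReal.coe_le_coe_iff] at hle
  have hval : ((k : ℝ) - i) * ((k - j) / (k - i) * x + (j - i) / (k - i) * y)
      = (k - j) * x + (j - i) * y := by
    field_simp
  calc ((k : ℝ) - i) * b ≤ (k - j) * x + (j - i) * y := by
        rw [← hval]; exact mul_le_mul_of_nonneg_left hle hik'.le
    _ ≤ (k - j) * (a + η / (k - i)) + (j - i) * (c + η / (k - i)) := by gcongr
    _ = (k - j) * a + (j - i) * c + η := by field_simp; ring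

end PosConvex

theorem exists_row_of_mem_genSet {N : Set (ℝ × ℝ)} {s : ℕ} {p : ℝ × ℝ} (hp : p ∈ genSet N s) :
    ∃ t : ℤ, t ≠ s ∧ p.2 = t ∧ lamN N t = p.1 := by
  rcases hp with ⟨⟨t, ht, hl, -⟩, hne⟩ | ⟨t, ht, hp2, hl⟩
  · refine ⟨t, fun h => hne ?_, by simpa using ht, hl.symm⟩
    obtain rfl : t = s := by exact_mod_cast h
    exact ⟨ht, hl⟩
  · exact ⟨t, by lia, hp2, hl.symm⟩

namespace IsPlanning

variable {N N' : Set (ℝ × ℝ)} {s : ℕ}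

/-- A line of nonpositive slope below all lattice rows of `N` except possibly row `s` bounds the
rows of an `s`-planning of `N`. -/
theorem le_lamN (h : IsPlanning N N' s) {m : ℤ} {B c : ℝ} (hB : 0 ≤ B)
    (hline : ∀ (t : ℤ) (x : ℝ), t ≠ s → lamN N t = x → c ≤ x + B * (t - m)) :
    (c : EReal) ≤ lamN N' m := by
  refine le_sInf ?_
  rintro _ ⟨l, hl, rfl⟩
  have := posHullSet_halfPlane (a := 1) (b := B) (c := c + B * m) zero_le_one hB
    (fun p hp => by
      obtain ⟨t, hts, hp2, hlt⟩ := exists_row_of_mem_genSet hp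
      rw [hp2]
      linarith [hline t p.1 hts hlt]) (h hl)
  exact EReal.coe_le_coe_iff.2 (by linarith)

theorem lamN_eq_top (h : IsPlanning N N' s) {m : ℤ}
    (hrow : ∀ t : ℤ, t ≠ s → lamN N t ≠ ⊤ → m < t) : lamN N' m = ⊤ := by
  refine top_le_iff.1 (le_sInf ?_)
  rintro _ ⟨l, hl, rfl⟩
  have := posHullSet_halfPlane (a := 0) (b := 1) (c := (m : ℝ) + 1) le_rfl zero_le_one
    (fun p hp => by
      obtain ⟨t, hts, hp2, hlt⟩ := exists_row_of_mem_genSet hp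
      have hmt : m + 1 ≤ t := hrow t hts (by simp [hlt])
      have hmt' : (m : ℝ) + 1 ≤ t := by exact_mod_cast hmt
      rw [hp2]
      linarith) (h hl)
  simp only at this
  linarith

theorem lamN_le_lamN (h : IsPlanning N N' s) (hN : PosConvex N) (m : ℤ) :
    lamN N m ≤ lamN N' m := by
  by_cases hm : lamN N m = ⊤
  · rw [h.lamN_eq_top fun t _ ht => ?_]
    · exact le_top
    by_contra! hle
    exact ht (top_le_iff.1 (hm ▸ hN.lamN_antitone hle))
  obtain ⟨b, hb⟩ := hN.exists_lamN_eq_coe hm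
  have hanti := hN.lamN_antitone (show m ≤ m + 1 by lia)
  obtain ⟨c, hc⟩ := hN.exists_lamN_eq_coe (ne_top_of_le_ne_top hm hanti)
  rw [hb, hc, EReal.coe_le_coe_iff] at hanti
  rw [hb]
  refine h.le_lamN (sub_nonneg.2 hanti) fun t x _ hx => ?_
  rcases le_or_gt t m with ht | ht
  · have := hN.lamN_convex ht (show m ≤ m + 1 by lia) hx hb hc
    push_cast at this
    linarith
  · have := hN.lamN_convex (show m ≤ m + 1 by lia) (show m + 1 ≤ t by lia) hb hc hx
    push_cast at this
    linarith

theorem lamN_add_le_lamN (h : IsPlanning N N' s) (hN : PosConvex N) {θ : ℝ} (hθ : 0 < θ)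
    (hsharp : (θ : EReal) ≤ sharpN N s) : lamN N s + ((θ / 2 : ℝ) : EReal) ≤ lamN N' s := by
  have hs : lamN N s ≠ ⊤ := by
    intro hs
    rw [sharpN, if_pos hs] at hsharp
    exact absurd (EReal.coe_nonpos.1 hsharp) hθ.not_ge
  by_cases hpred : lamN N (s - 1) = ⊤
  · rw [h.lamN_eq_top fun t hts ht => ?_]
    · exact le_top
    by_contra! hle
    exact ht (top_le_iff.1 (hpred ▸ hN.lamN_antitone (show t ≤ s - 1 by lia)))
  rw [sharpN, if_neg hs, if_neg hpred] at hsharp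
  obtain ⟨b, hb⟩ := hN.exists_lamN_eq_coe hs
  obtain ⟨a, ha⟩ := hN.exists_lamN_eq_coe hpred
  obtain ⟨c, hc⟩ := hN.exists_lamN_eq_coe
    (ne_top_of_le_ne_top hs (hN.lamN_antitone (show (s : ℤ) ≤ s + 1 by lia)))
  have hac := hN.lamN_antitone (show (s : ℤ) - 1 ≤ s + 1 by lia)
  rw [ha, hc, EReal.coe_le_coe_iff] at hac
  rw [ha, hb, hc] at hsharp
  have hsharp' : θ ≤ a + c - 2 * b := by
    have h2 : (2 : EReal) = ((2 : ℝ) : EReal) := rfl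
    rw [h2] at hsharp
    exact_mod_cast hsharp
  rw [hb, ← EReal.coe_add]
  refine h.le_lamN (B := (a - c) / 2) (by linarith) fun t x hts hx => ?_
  rcases lt_or_gt_of_ne hts with ht | ht
  · have := hN.lamN_convex (show t ≤ s - 1 by lia) (show (s : ℤ) - 1 ≤ s + 1 by lia) hx ha hc
    push_cast at this ⊢
    linarith
  · have := hN.lamN_convex (show (s : ℤ) - 1 ≤ s + 1 by lia) (show (s : ℤ) + 1 ≤ t by lia) ha hc hx
    push_cast at this ⊢
    linarith

end IsPlanning

/-- The abscissa of `N` at height `m`, truncated at `M`. -/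
def truncLam (M : ℝ) (N : Set (ℝ × ℝ)) (m : ℕ) : ℝ :=
  (min (lamN N (m : ℤ)) (M : EReal)).toReal

namespace PosConvex

variable {N N' : Set (ℝ × ℝ)} {M : ℝ} {m : ℕ}

theorem coe_truncLam (hN : PosConvex N) (hM : 0 ≤ M) :
    ((truncLam M N m : ℝ) : EReal) = min (lamN N m) M :=
  EReal.coe_toReal (ne_top_of_le_ne_top (EReal.coe_ne_top M) (min_le_right _ _))
    (ne_bot_of_le_ne_bot EReal.zero_ne_bot
      (le_min (hN.lamN_nonneg m) (EReal.coe_nonneg.2 hM)))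

theorem truncLam_nonneg (hN : PosConvex N) (hM : 0 ≤ M) : 0 ≤ truncLam M N m := by
  rw [← EReal.coe_nonneg, hN.coe_truncLam hM]
  exact le_min (hN.lamN_nonneg m) (EReal.coe_nonneg.2 hM)

theorem truncLam_le (hN : PosConvex N) (hM : 0 ≤ M) : truncLam M N m ≤ M := by
  rw [← EReal.coe_le_coe_iff, hN.coe_truncLam hM]
  exact min_le_right _ _

theorem truncLam_le_truncLam (hN : PosConvex N) (hN' : PosConvex N') (hM : 0 ≤ M)
    (h : lamN N m ≤ lamN N' m) : truncLam M N m ≤ truncLam M N' m := by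
  rw [← EReal.coe_le_coe_iff, hN.coe_truncLam hM, hN'.coe_truncLam hM]
  exact min_le_min_right _ h

theorem truncLam_add_le_truncLam (hN : PosConvex N) (hN' : PosConvex N') {ρ η : ℝ}
    (hM : 0 ≤ ρ + η) (hρ : lamN N m ≤ (ρ : EReal))
    (h : lamN N m + (η : EReal) ≤ lamN N' m) :
    truncLam (ρ + η) N m + η ≤ truncLam (ρ + η) N' m := by
  rw [← EReal.coe_le_coe_iff, EReal.coe_add, hN.coe_truncLam hM, hN'.coe_truncLam hM]
  refine le_min ((add_le_add_left (min_le_left _ _) _).trans h) ?_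
  rw [EReal.coe_add]
  exact add_le_add_left ((min_le_left _ _).trans hρ) _

end PosConvex

theorem thetaVal_pos (δ ρ : ℝ) {ε : ℝ} (hε : 0 < ε) (h : ℕ) : 0 < thetaVal δ ρ ε h :=
  lt_min one_pos (by positivity)

theorem PlanOp.sum_truncLam_add_le {δ ρ ε : ℝ} {h : ℕ} {N N' : Set (ℝ × ℝ)} (hρ : 0 ≤ ρ)
    (hδ : 0 < δ) (hε : 0 < ε) (hh : ρ / δ < h) (hN : PosConvex N) (hop : PlanOp δ ρ ε h N N') :
    ∑ m ∈ Finset.range h, truncLam (ρ + thetaVal δ ρ ε h / 2) N m + thetaVal δ ρ ε h / 2 ≤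
      ∑ m ∈ Finset.range h, truncLam (ρ + thetaVal δ ρ ε h / 2) N' m := by
  obtain ⟨hN', s, hlt, hsharp, hplan⟩ := hop
  have hθ := thetaVal_pos δ ρ hε h
  have hM : 0 ≤ ρ + thetaVal δ ρ ε h / 2 := by positivity
  have hsρ : s * δ < ρ := by
    have := EReal.coe_pos.1 ((hN.lamN_nonneg s).trans_lt hlt)
    linarith
  have hs : s ∈ Finset.range h := by
    rw [Finset.mem_range]
    exact_mod_cast ((lt_div_iff₀ hδ).2 hsρ).trans hh
  have hle : lamN N s ≤ (ρ : EReal) :=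
    hlt.le.trans (EReal.coe_le_coe_iff.2 (sub_le_self _ (by positivity)))
  rw [← Finset.add_sum_erase _ _ hs, ← Finset.add_sum_erase _ _ hs, add_right_comm]
  exact add_le_add
    (hN.truncLam_add_le_truncLam hN' hM hle (hplan.lamN_add_le_lamN hN hθ hsharp))
    (Finset.sum_le_sum fun m _ => hN.truncLam_le_truncLam hN' hM (hplan.lamN_le_lamN hN m))

/-- there is a bound, depending only on `δ, ρ, ε`, on the length of any
chain of `(δ,ρ,ε)`-planning operations. -/
theorem statement11 (δ ρ ε : ℝ) (hρ : 0 ≤ ρ) (hδ : 0 < δ) (hε : 0 < ε)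
    (h : ℕ) (hh : ρ / δ < (h : ℝ)) (hmin : ∀ h' : ℕ, ρ / δ < (h' : ℝ) → h ≤ h') :
    ∃ b : ℕ, ∀ (t : ℕ) (Ns : ℕ → Set (ℝ × ℝ)), PosConvex (Ns 0) →
      (∀ i < t, PlanOp δ ρ ε h (Ns i) (Ns (i + 1))) → t ≤ b := by
  have hθ := thetaVal_pos δ ρ hε h
  set η := thetaVal δ ρ ε h / 2 with hη_def
  have hη : 0 < η := by positivity
  have hM : 0 ≤ ρ + η := by positivity
  refine ⟨⌈h * (ρ + η) / η⌉₊, fun t Ns h0 hop => ?_⟩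
  have hpos : ∀ i ≤ t, PosConvex (Ns i) := by
    rintro (_ | i) hi
    · exact h0
    · exact (hop i hi).1
  have hgrow : ∀ i ≤ t, (i : ℝ) * η ≤ ∑ m ∈ Finset.range h, truncLam (ρ + η) (Ns i) m := by
    intro i
    induction i with
    | zero =>
      intro _
      simpa using Finset.sum_nonneg fun m _ => h0.truncLam_nonneg hM
    | succ i ih =>
      intro hi
      have := (hop i hi).sum_truncLam_add_le hρ hδ hε hh (hpos i (by lia))
      rw [← hη_def] at this
      push_cast
      linarith [ih (by lia)]
  have hbound : ∑ m ∈ Finset.range h, truncLam (ρ + η) (Ns t) m ≤ h * (ρ + η) := by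
    simpa only [Finset.card_range, nsmul_eq_mul] using Finset.sum_le_card_nsmul (Finset.range h) (truncLam (ρ + η) (Ns t)) (ρ + η)
      fun _ _ => (hpos t le_rfl).truncLam_le hM
  have ht : (t : ℝ) ≤ h * (ρ + η) / η := (le_div_iff₀ hη).2 ((hgrow t le_rfl).trans hbound)
  exact_mod_cast ht.trans (Nat.le_ceil _)
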